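/- Discrete-time non-oscillation principle (eventually cooperative case): Let T : ℝ^N → ℝ^N be a bijection and suppose T is eventually cooperative, i.e. there exists an integer n* ≥ 1 such that for every n ≥ n*, x < y implies Tⁿx < Tⁿy. Then for every point z, the full orbit {Tᵐ z : m ∈ ℤ} cannot have both an increasing segment and a decreasing segment; that is, there do not exist integers m < n and k < l with Tᵐ z < Tⁿ z and Tᵏ z > Tˡ z (where Tᵐ for m ∈ ℤ denotes the m-th iterate of T, using the inverse for negative m). -/

import Mathlib

open Filter Topology

variable {N : ℕ}

/-- `x ≤ y` in the partial order induced by the cone `C`: `y - x ∈ C`. -/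
def coneLE (C : Set (EuclideanSpace ℝ (Fin N))) (x y : EuclideanSpace ℝ (Fin N)) : Prop :=
  y - x ∈ C

/-- `x < y` in the partial order induced by the cone `C`: `y - x ∈ C \ {0}`. -/
def coneLT (C : Set (EuclideanSpace ℝ (Fin N))) (x y : EuclideanSpace ℝ (Fin N)) : Prop :=
  y - x ∈ C \ {0}

/-- `x ≪ y` in the partial order induced by the cone `C`: `y - x ∈ interior C`. -/
def coneLLT (C : Set (EuclideanSpace ℝ (Fin N))) (x y : EuclideanSpace ℝ (Fin N)) : Prop :=
  y - x ∈ interior C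

/-- `C` is a closed convex cone that is salient: `C ∩ (-C) = {0}`. -/
def IsClosedSalientConvexCone (C : Set (EuclideanSpace ℝ (Fin N))) : Prop :=
  IsClosed C ∧ (∀ x ∈ C, ∀ y ∈ C, x + y ∈ C) ∧
    (∀ (a : ℝ), 0 ≤ a → ∀ x ∈ C, a • x ∈ C) ∧ C ∩ (-C) = {0}

/-- `φ` is a continuous flow on `ℝ^N`. -/
def IsFlow (φ : ℝ → EuclideanSpace ℝ (Fin N) → EuclideanSpace ℝ (Fin N)) : Prop :=
  (∀ t : ℝ, Continuous (φ t)) ∧ (φ 0 = id) ∧ (∀ s t : ℝ, φ (s + t) = φ s ∘ φ t)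

/-- `φ` is eventually cooperative with transient `tstar`:
it preserves the cone order in forward time after time `tstar`. -/
def EventuallyCooperative (C : Set (EuclideanSpace ℝ (Fin N)))
    (φ : ℝ → EuclideanSpace ℝ (Fin N) → EuclideanSpace ℝ (Fin N)) (tstar : ℝ) : Prop :=
  ∀ x y, coneLE C x y → ∀ t : ℝ, tstar ≤ t → coneLE C (φ t x) (φ t y)

/-- `φ` is eventually competitive with transient `tstar`:
it preserves the cone order in backward time after time `tstar`. -/
def EventuallyCompetitive (C : Set (EuclideanSpace ℝ (Fin N)))
    (φ : ℝ → EuclideanSpace ℝ (Fin N) → EuclideanSpace ℝ (Fin N)) (tstar : ℝ) : Prop :=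
  ∀ x y, coneLE C x y → ∀ t : ℝ, t ≤ -tstar → coneLE C (φ t x) (φ t y)

/-- The ω-limit set of `x`: all limits of sequences `φ_{t_k} x` with `t_k → +∞`. -/
def omegaLimitSet (φ : ℝ → EuclideanSpace ℝ (Fin N) → EuclideanSpace ℝ (Fin N))
    (x : EuclideanSpace ℝ (Fin N)) : Set (EuclideanSpace ℝ (Fin N)) :=
  {y | ∃ tk : ℕ → ℝ, Tendsto tk atTop atTop ∧ Tendsto (fun k => φ (tk k) x) atTop (𝓝 y)}

/-- The α-limit set of `x`: all limits of sequences `φ_{t_k} x` with `t_k → -∞`. -/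
def alphaLimitSet (φ : ℝ → EuclideanSpace ℝ (Fin N) → EuclideanSpace ℝ (Fin N))
    (x : EuclideanSpace ℝ (Fin N)) : Set (EuclideanSpace ℝ (Fin N)) :=
  {y | ∃ tk : ℕ → ℝ, Tendsto tk atTop atBot ∧ Tendsto (fun k => φ (tk k) x) atTop (𝓝 y)}

/-- The strict order of a salient convex cone is transitive. -/
theorem coneLT_trans {C : Set (EuclideanSpace ℝ (Fin N))} (hC : IsClosedSalientConvexCone C)
    {x y w : EuclideanSpace ℝ (Fin N)} (hxy : coneLT C x y) (hyw : coneLT C y w) :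
    coneLT C x w := by
  obtain ⟨-, hadd, -, hsal⟩ := hC
  have hsum : w - x = (w - y) + (y - x) := by abel
  refine ⟨hsum ▸ hadd _ hyw.1 _ hxy.1, fun h0 => hxy.2 ?_⟩
  rw [Set.mem_singleton_iff, hsum] at h0
  rw [← hsal]
  exact ⟨hxy.1, by rw [Set.mem_neg, ← eq_neg_of_add_eq_zero_left h0]; exact hyw.1⟩

/-- The strict order of a cone is irreflexive. -/
theorem coneLT_irrefl (C : Set (EuclideanSpace ℝ (Fin N))) (x : EuclideanSpace ℝ (Fin N)) :
    ¬ coneLT C x x :=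
  fun h => h.2 (sub_self x)

/-- A transitive relation between each term and its shift by `p`, valid from index `a` on,
extends to shifts by positive multiples of `p`. -/
theorem rel_add_mul_of_rel_add {α : Type*} {R : α → α → Prop}
    (htrans : ∀ {x y w}, R x y → R y w → R x w) {u : ℤ → α} {a p : ℤ} (hp : 0 ≤ p)
    (h : ∀ i, a ≤ i → R (u i) (u (i + p))) {i : ℤ} (hi : a ≤ i) (r : ℕ) :
    R (u i) (u (i + (r + 1) * p)) := by
  induction r with
  | zero => simpa using h i hi
  | succ r ih =>
    have hstep := h (i + (r + 1) * p) (by nlinarith [Int.natCast_nonneg r])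
    have hindex : i + (r + 1) * p + p = i + ((r + 1 : ℕ) + 1) * p := by push_cast; ring
    exact htrans ih (hindex ▸ hstep)

/-- If `T` is eventually cooperative, an ordered pair of orbit points stays ordered under all
sufficiently large shifts. -/
theorem coneLT_orbit_add {C : Set (EuclideanSpace ℝ (Fin N))}
    {T : Equiv.Perm (EuclideanSpace ℝ (Fin N))} {nstar : ℤ}
    (hcoop : ∀ n : ℤ, nstar ≤ n → ∀ x y : EuclideanSpace ℝ (Fin N),
        coneLT C x y → coneLT C ((T ^ n) x) ((T ^ n) y))
    {z : EuclideanSpace ℝ (Fin N)} {m n : ℤ} (h : coneLT C ((T ^ m) z) ((T ^ n) z))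
    {s : ℤ} (hs : nstar ≤ s) : coneLT C ((T ^ (s + m)) z) ((T ^ (s + n)) z) := by
  simpa only [zpow_add, Equiv.Perm.mul_apply] using hcoop s hs _ _ h

theorem discrete_nonoscillation_eventually_cooperative
    (C : Set (EuclideanSpace ℝ (Fin N))) (hC : IsClosedSalientConvexCone C)
    (T : Equiv.Perm (EuclideanSpace ℝ (Fin N)))
    (nstar : ℤ) (hnstar : 1 ≤ nstar)
    (hcoop : ∀ n : ℤ, nstar ≤ n → ∀ x y : EuclideanSpace ℝ (Fin N),
        coneLT C x y → coneLT C ((T ^ n) x) ((T ^ n) y))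
    (z : EuclideanSpace ℝ (Fin N)) :
    ¬ ∃ m n k l : ℤ, m < n ∧ k < l ∧
        coneLT C ((T ^ m) z) ((T ^ n) z) ∧ coneLT C ((T ^ l) z) ((T ^ k) z) := by
  rintro ⟨m, n, k, l, hmn, hkl, hinc, hdec⟩
  obtain ⟨p, hp⟩ := Int.eq_ofNat_of_zero_le (a := n - m - 1) (by omega)
  obtain ⟨q, hq⟩ := Int.eq_ofNat_of_zero_le (a := l - k - 1) (by omega)
  have hup : ∀ i, nstar + m ≤ i → coneLT C ((T ^ i) z) ((T ^ (i + (p + 1))) z) := by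
    intro i hi
    have h := coneLT_orbit_add hcoop hinc (s := i - m) (by omega)
    rwa [sub_add_cancel, show i - m + n = i + (p + 1) by omega] at h
  have hdown : ∀ i, nstar + k ≤ i → coneLT C ((T ^ (i + (q + 1))) z) ((T ^ i) z) := by
    intro i hi
    have h := coneLT_orbit_add hcoop hdec (s := i - k) (by omega)
    rwa [sub_add_cancel, show i - k + l = i + (q + 1) by omega] at h
  let i := max (nstar + m) (nstar + k)
  have hlt := rel_add_mul_of_rel_add (R := coneLT C) (u := fun j => (T ^ j) z) (coneLT_trans hC)
    (p := p + 1) (by omega) hup (le_max_left _ _ : _ ≤ i) q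
  have hgt := rel_add_mul_of_rel_add (R := fun x y => coneLT C y x) (u := fun j => (T ^ j) z)
    (fun hxy hyw => coneLT_trans hC hyw hxy) (p := q + 1) (by omega) hdown
    (le_max_right _ _ : _ ≤ i) p
  rw [mul_comm] at hgt
  exact coneLT_irrefl C _ (coneLT_trans hC hlt hgt)
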